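/- Consider the Gaussian additive model with priors {P_N}, M_N → ∞, and set λ_N = 2 log M_N. Suppose {P_N} has overlap rate function r, i.e., for every t ∈ [−1,1], limsup_{N→∞} (1/log M_N)·log P_N^{⊗2}[⟨X,X'⟩ ≥ t] ≤ −r(t) for a nondecreasing r: [−1,1] → [0,∞). Then the events Ω_N = {(x,y) : |⟨x,y⟩ − √λ_N| ≤ λ_N^{1/4}} occur with uniformly high probability at SNR λ_N, and the conditional law Q̃_{λ_N,N} of Y = √λ_N·X + Z given (X,Y) ∈ Ω_N satisfies limsup_{N→∞} (1/λ_N)·D(Q̃_{λ_N,N} ‖ Q_{0,N}) ≤ sup_{t ∈ [0,1]} max(t/(1+t) − r(t)/2, 0). -/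

import Mathlib

open MeasureTheory ProbabilityTheory Filter Real
open scoped ENNReal NNReal

noncomputable section

/-- Vectors in `ℝ^N`. -/
abbrev V (N : ℕ) : Type := Fin N → ℝ

/-- Euclidean inner product on `ℝ^N`. -/
def inp {N : ℕ} (x y : V N) : ℝ := ∑ i, x i * y i

/-- `S` is a subset of the unit sphere of `ℝ^N`. -/
def onSphere {N : ℕ} (S : Finset (V N)) : Prop := ∀ x ∈ S, ∑ i, (x i) ^ 2 = 1

/-- The standard Gaussian measure on `ℝ^N`. -/
def stdGaussian (N : ℕ) : Measure (V N) :=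
  Measure.pi fun _ : Fin N => gaussianReal 0 1

/-- The uniform probability measure on a finite set of vectors. -/
def unifOn {N : ℕ} (S : Finset (V N)) : Measure (V N) :=
  (S.card : ℝ≥0∞)⁻¹ • ∑ x ∈ S, Measure.dirac x

/-- The joint law of `(X, Y)` where `X` is uniform on `S`, `Z` is an independent standard
Gaussian vector, and `Y = √λ • X + Z`. -/
def jointLaw (N : ℕ) (S : Finset (V N)) (lam : ℝ) : Measure (V N × V N) :=
  ((unifOn S).prod (stdGaussian N)).map
    (fun q => (q.1, fun i => Real.sqrt lam * q.1 i + q.2 i))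

/-- `Q N S lam` : the law of the observation `Y = √λ • X + Z`. -/
def Q (N : ℕ) (S : Finset (V N)) (lam : ℝ) : Measure (V N) :=
  (jointLaw N S lam).map Prod.snd

/-- Kullback–Leibler divergence `D(μ ‖ ν) = ∫ log (dμ/dν) dμ` (real-valued). -/
def klReal {α : Type*} [MeasurableSpace α] (μ ν : Measure α) : ℝ :=
  ∫ x, Real.log (μ.rnDeriv ν x).toReal ∂μ

/-- The σ-algebra generated by the observation `Y` (the second coordinate). -/
def sigmaY (N : ℕ) : MeasurableSpace (V N × V N) :=
  MeasurableSpace.comap Prod.snd inferInstance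

/-- The minimum mean squared error `E‖X - E[X | Y]‖²` at SNR `lam`. -/
def mmse (N : ℕ) (S : Finset (V N)) (lam : ℝ) : ℝ :=
  ∑ i : Fin N,
    ∫ ω, (ω.1 i - ((jointLaw N S lam)[fun ω' => ω'.1 i | sigmaY N]) ω) ^ 2
      ∂(jointLaw N S lam)

/-- The all-or-nothing phenomenon with critical SNR sequence `lam`. -/
def allOrNothing (S : ∀ N : ℕ, Finset (V N)) (lam : ℕ → ℝ) : Prop :=
  (∀ β : ℝ, 0 ≤ β → β < 1 →
    Tendsto (fun N => mmse N (S N) (β * lam N)) atTop (nhds 1)) ∧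
  (∀ β : ℝ, 1 < β →
    Tendsto (fun N => mmse N (S N) (β * lam N)) atTop (nhds 0))

/-- `limsup_N (1 / log M_N) · log P_N^{⊗2}[⟨X, X'⟩ ≥ t] ≤ c`, where `X, X'` are i.i.d.
draws from the uniform distribution on `S N`: for every `ε > 0`, eventually the probability
that the overlap is at least `t` is at most `M_N ^ (c + ε)`. -/
def overlapRateLe (S : ∀ N : ℕ, Finset (V N)) (t c : ℝ) : Prop :=
  ∀ ε : ℝ, 0 < ε → ∀ᶠ N in atTop,
    ((unifOn (S N)).prod (unifOn (S N))) {q | t ≤ inp q.1 q.2}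
      ≤ ((S N).card : ℝ≥0∞) ^ (c + ε)

/-- The spread assumption: `lim_{t→1⁻} limsup_N (1/log M_N) log P_N^{⊗2}[⟨X,X'⟩ ≥ t] ≤ -1`. -/
def spread (S : ∀ N : ℕ, Finset (V N)) : Prop :=
  ∀ ε : ℝ, 0 < ε → ∃ t₀ : ℝ, t₀ < 1 ∧ ∀ t : ℝ, t₀ < t → t < 1 →
    overlapRateLe S t (-1 + ε)

/-- A sequence of events `Ω_N ⊆ ℝ^N × ℝ^N` occurs with uniformly high probability at SNR
`λ_N` if `sup_{x ∈ S_N} Pr_Z[(x, √λ_N x + Z) ∉ Ω_N] → 0` as `N → ∞`. -/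
def uniformlyHigh (S : ∀ N : ℕ, Finset (V N)) (lam : ℕ → ℝ)
    (Om : ∀ N : ℕ, Set (V N × V N)) : Prop :=
  ∀ ε : ℝ, 0 < ε → ∀ᶠ N in atTop, ∀ x ∈ S N,
    stdGaussian N {z | (x, fun i => Real.sqrt (lam N) * x i + z i) ∉ Om N}
      ≤ ENNReal.ofReal ε

/-- The conditional law `Q̃` of the observation `Y`, given that `(X, Y)` lies in the
event `Om`. -/
def condQ (N : ℕ) (S : Finset (V N)) (lam : ℝ) (Om : Set (V N × V N)) : Measure (V N) :=
  ((jointLaw N S lam)[|Om]).map Prod.snd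

instance stdGaussian_prob (N : ℕ) : IsProbabilityMeasure (stdGaussian N) := by
  unfold _root_.stdGaussian; infer_instance

lemma measurable_inp {N : ℕ} : Measurable (fun q : V N × V N => inp q.1 q.2) := by
  unfold inp; fun_prop

lemma measurable_inp_right {N : ℕ} (x : V N) : Measurable (fun y : V N => inp x y) := by
  unfold inp; fun_prop

lemma gauss_shift (a : ℝ) :
    (gaussianReal 0 1).map (fun z => a + z)
      = (gaussianReal 0 1).withDensity (fun y => ENNReal.ofReal (Real.exp (a * y - a ^ 2 / 2))) := by
  rw [gaussianReal_map_const_add, gaussianReal_of_var_ne_zero _ one_ne_zero,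
    gaussianReal_of_var_ne_zero _ one_ne_zero, ← withDensity_mul _ (by fun_prop) (by fun_prop)]
  congr 1
  ext y
  simp only [gaussianPDF, Pi.mul_apply]
  rw [← ENNReal.ofReal_mul (gaussianPDFReal_nonneg _ _ _)]
  congr 1
  simp only [gaussianPDFReal]
  rw [mul_assoc _ (Real.exp _) (Real.exp _), ← Real.exp_add]
  congr 2
  simp
  ring

lemma std_shift {N : ℕ} (a : V N) :
    (stdGaussian N).map (fun z i => a i + z i)
      = (stdGaussian N).withDensity
          (fun y => ENNReal.ofReal (Real.exp (inp a y - inp a a / 2))) := by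
  have hsf : ∀ i, SigmaFinite ((gaussianReal 0 1).map (fun z => a i + z)) := by
    intro i
    rw [gaussianReal_map_const_add]; infer_instance
  unfold _root_.stdGaussian
  rw [Measure.pi_map_pi (f := fun i z => a i + z) (fun i => by fun_prop)]
  refine Measure.pi_eq fun s hs => ?_
  rw [withDensity_apply _ (MeasurableSet.univ_pi hs), ← lintegral_indicator (MeasurableSet.univ_pi hs)]
  have h1 : ∀ y : V N, (Set.univ.pi s).indicator
      (fun y => ENNReal.ofReal (Real.exp (inp a y - inp a a / 2))) y
      = ∏ i, (s i).indicator (fun y => ENNReal.ofReal (Real.exp (a i * y - a i ^ 2 / 2))) (y i) := by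
    intro y
    by_cases hy : y ∈ Set.univ.pi s
    · rw [Set.indicator_of_mem hy]
      rw [Finset.prod_congr rfl (fun i _ => Set.indicator_of_mem (hy i (Set.mem_univ i)) _)]
      rw [← ENNReal.ofReal_prod_of_nonneg (fun i _ => (Real.exp_pos _).le), ← Real.exp_sum]
      congr 2
      unfold inp
      rw [Finset.sum_div, ← Finset.sum_sub_distrib]
      refine Finset.sum_congr rfl fun i _ => by ring
    · rw [Set.indicator_of_notMem hy]
      simp only [Set.mem_pi, Set.mem_univ, forall_const, not_forall] at hy
      obtain ⟨i, hi⟩ := hy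
      exact (Finset.prod_eq_zero (Finset.mem_univ i) (Set.indicator_of_notMem hi _)).symm
  simp_rw [h1]
  have hm : ∀ i, Measurable ((s i).indicator
      (fun y => ENNReal.ofReal (Real.exp (a i * y - a i ^ 2 / 2)))) := fun i =>
    Measurable.indicator (by fun_prop) (hs i)
  rw [lintegral_prod_eq_prod_lintegral_of_indepFun Finset.univ
    (fun i (y : V N) => (s i).indicator
      (fun y => ENNReal.ofReal (Real.exp (a i * y - a i ^ 2 / 2))) (y i))
    (iIndepFun_pi (fun i => (hm i).aemeasurable)) (fun i => (hm i).comp (measurable_pi_apply i))]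
  refine Finset.prod_congr rfl fun i _ => ?_
  rw [(measurePreserving_eval (fun _ : Fin N => gaussianReal 0 1) i).lintegral_comp (hm i),
    lintegral_indicator (hs i), ← withDensity_apply _ (hs i), gauss_shift]

lemma std_mgf {N : ℕ} (a : V N) :
    ∫⁻ y, ENNReal.ofReal (Real.exp (inp a y)) ∂(stdGaussian N)
      = ENNReal.ofReal (Real.exp (inp a a / 2)) := by
  have h := congrArg (fun μ => μ Set.univ) (std_shift a)
  have hm : Measurable (fun (z : V N) (i : Fin N) => a i + z i) := by fun_prop
  simp only [withDensity_apply _ MeasurableSet.univ, Measure.restrict_univ] at h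
  rw [Measure.map_apply hm MeasurableSet.univ, Set.preimage_univ, measure_univ] at h
  have h2 : ∀ y, ENNReal.ofReal (Real.exp (inp a y)) = ENNReal.ofReal (Real.exp (inp a a / 2)) *
      ENNReal.ofReal (Real.exp (inp a y - inp a a / 2)) := by
    intro y
    rw [← ENNReal.ofReal_mul (Real.exp_pos _).le, ← Real.exp_add]
    congr 2; ring
  simp_rw [h2]
  rw [lintegral_const_mul' _ _ ENNReal.ofReal_ne_top, ← h, mul_one]

lemma inp_self {N : ℕ} {S : Finset (V N)} (hS : onSphere S) {x : V N} (hx : x ∈ S) :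
    inp x x = 1 := by
  rw [← hS x hx]; unfold inp; exact Finset.sum_congr rfl fun i _ => by ring

lemma inp_le_one {N : ℕ} {x y : V N} (hx : inp x x = 1) (hy : inp y y = 1) : inp x y ≤ 1 := by
  have h : 0 ≤ ∑ i, (x i - y i) ^ 2 := Finset.sum_nonneg fun i _ => sq_nonneg _
  have h2 : ∑ i, (x i - y i) ^ 2 = inp x x + inp y y - 2 * inp x y := by
    unfold inp
    rw [Finset.mul_sum, ← Finset.sum_add_distrib, ← Finset.sum_sub_distrib]
    exact Finset.sum_congr rfl fun i _ => by ring
  linarith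

lemma inp_comm {N : ℕ} (x y : V N) : inp x y = inp y x := by
  unfold inp; exact Finset.sum_congr rfl fun i _ => mul_comm _ _

lemma inp_smul_left {N : ℕ} (c : ℝ) (x y : V N) : inp (fun i => c * x i) y = c * inp x y := by
  unfold inp; rw [Finset.mul_sum]; exact Finset.sum_congr rfl fun i _ => by ring

lemma inp_add_left {N : ℕ} (x x' y : V N) :
    inp (fun i => x i + x' i) y = inp x y + inp x' y := by
  unfold inp; rw [← Finset.sum_add_distrib]; exact Finset.sum_congr rfl fun i _ => by ring

lemma inp_smul_right {N : ℕ} (c : ℝ) (x y : V N) : inp y (fun i => c * x i) = c * inp y x := by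
  rw [inp_comm, inp_smul_left, inp_comm]

lemma inp_add_right {N : ℕ} (x x' y : V N) :
    inp y (fun i => x i + x' i) = inp y x + inp y x' := by
  rw [inp_comm, inp_add_left, inp_comm, inp_comm x']

/-- Gaussian tail bound. -/
lemma std_tail {N : ℕ} {x : V N} (hx : inp x x = 1) (s : ℝ) :
    stdGaussian N {z | ¬ |inp x z| ≤ s} ≤ ENNReal.ofReal (2 * Real.exp (1 / 2 - s)) := by
  have key : ∀ x : V N, inp x x = 1 →
      stdGaussian N {z | s ≤ inp x z} ≤ ENNReal.ofReal (Real.exp (1 / 2 - s)) := by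
    intro x hx
    have h1 := mul_meas_ge_le_lintegral (μ := stdGaussian N)
      (f := fun y => ENNReal.ofReal (Real.exp (inp x y)))
      (by have := measurable_inp_right x; fun_prop) (ENNReal.ofReal (Real.exp s))
    rw [std_mgf, hx] at h1
    have h2 : {z | s ≤ inp x z} ⊆
        {z | ENNReal.ofReal (Real.exp s) ≤ ENNReal.ofReal (Real.exp (inp x z))} := by
      intro z hz
      exact ENNReal.ofReal_le_ofReal (Real.exp_le_exp.2 hz)
    have h3 : ENNReal.ofReal (Real.exp s) * ENNReal.ofReal (Real.exp (-s)) = 1 := by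
      rw [← ENNReal.ofReal_mul (Real.exp_pos _).le, ← Real.exp_add]; simp
    calc stdGaussian N {z | s ≤ inp x z}
        ≤ _ := measure_mono h2
      _ = ENNReal.ofReal (Real.exp (-s)) * (ENNReal.ofReal (Real.exp s) * stdGaussian N
            {z | ENNReal.ofReal (Real.exp s) ≤ ENNReal.ofReal (Real.exp (inp x z))}) := by
          rw [← mul_assoc, mul_comm (ENNReal.ofReal (Real.exp (-s))), h3, one_mul]
      _ ≤ ENNReal.ofReal (Real.exp (-s)) * ENNReal.ofReal (Real.exp (1 / 2)) := by gcongr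
      _ = _ := by
          rw [← ENNReal.ofReal_mul (Real.exp_pos _).le, ← Real.exp_add]; congr 2; ring
  have hneg : inp (fun i => (-1) * x i) (fun i => (-1) * x i) = 1 := by
    rw [inp_smul_left, inp_smul_right, hx]; norm_num
  calc stdGaussian N {z | ¬ |inp x z| ≤ s}
      ≤ stdGaussian N ({z | s ≤ inp x z} ∪ {z | s ≤ inp (fun i => (-1) * x i) z}) := by
        refine measure_mono fun z hz => ?_
        simp only [Set.mem_ofPred_eq, not_le, lt_abs] at hz
        simp only [Set.mem_union, Set.mem_ofPred_eq, inp_smul_left]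
        rcases hz with h | h
        · left; linarith
        · right; linarith
    _ ≤ _ := measure_union_le _ _
    _ ≤ _ := add_le_add (key _ hx) (key _ hneg)
    _ = _ := by
        rw [← ENNReal.ofReal_add (Real.exp_pos _).le (Real.exp_pos _).le]; congr 1; ring

/-- The truncated likelihood. -/
def G {N : ℕ} (c s : ℝ) (x y : V N) : ℝ≥0∞ :=
  {y | |inp x y - c| ≤ s}.indicator
    (fun y => ENNReal.ofReal (Real.exp (c * inp x y - c ^ 2 / 2))) y

lemma measurableSet_win {N : ℕ} (c s : ℝ) (x : V N) :
    MeasurableSet {y : V N | |inp x y - c| ≤ s} := by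
  have := measurable_inp_right x
  exact measurableSet_le (by fun_prop) measurable_const

lemma measurable_G {N : ℕ} (c s : ℝ) (x : V N) : Measurable (G c s x) := by
  have := measurable_inp_right x
  exact Measurable.indicator (by fun_prop) (measurableSet_win c s x)

lemma pair_bound {N : ℕ} {c s : ℝ} (hc : 0 ≤ c) (hs : 0 ≤ s) {x x' : V N}
    (hx : inp x x = 1) (hx' : inp x' x' = 1) :
    ∫⁻ y, G c s x y * G c s x' y ∂(stdGaussian N)
      ≤ ENNReal.ofReal (Real.exp
          (c ^ 2 * (max (inp x x') 0 / (1 + max (inp x x') 0)) + 2 * c * s)) := by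
  set τ := max (inp x x') 0 with hτ
  have hτ0 : 0 ≤ τ := le_max_right _ _
  have htτ : inp x x' ≤ τ := le_max_left _ _
  set θ := 1 / (1 + τ) with hθ
  have hθ0 : 0 ≤ θ := by positivity
  have hθ1 : θ ≤ 1 := by rw [hθ, div_le_one (by linarith)]; linarith
  have hθτ : θ * (1 + τ) = 1 := by rw [hθ]; field_simp
  set v : V N := fun i => (θ * c) * (x i + x' i) with hv
  have hvy : ∀ y, inp v y = θ * c * (inp x y + inp x' y) := by
    intro y; rw [hv, inp_smul_left, inp_add_left]
  have hvv : inp v v = (θ * c) ^ 2 * (2 + 2 * inp x x') := by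
    rw [hvy, inp_comm x v, inp_comm x' v, hvy, hvy, hx, hx', inp_comm x' x]; ring
  have hpt : ∀ y, G c s x y * G c s x' y ≤
      ENNReal.ofReal (Real.exp ((1 - θ) * c * (2 * c + 2 * s) - c ^ 2)) *
        ENNReal.ofReal (Real.exp (inp v y)) := by
    intro y
    unfold G
    by_cases h1 : y ∈ {y | |inp x y - c| ≤ s}
    · by_cases h2 : y ∈ {y | |inp x' y - c| ≤ s}
      · rw [Set.indicator_of_mem h1, Set.indicator_of_mem h2,
          ← ENNReal.ofReal_mul (Real.exp_pos _).le, ← ENNReal.ofReal_mul (Real.exp_pos _).le,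
          ← Real.exp_add, ← Real.exp_add, hvy]
        refine ENNReal.ofReal_le_ofReal (Real.exp_le_exp.2 ?_)
        have h3 := (abs_le.1 (show |inp x y - c| ≤ s from h1)).2
        have h4 := (abs_le.1 (show |inp x' y - c| ≤ s from h2)).2
        have h5 : 0 ≤ (1 - θ) * c * ((2 * c + 2 * s) - (inp x y + inp x' y)) :=
          mul_nonneg (mul_nonneg (by linarith) hc) (by linarith)
        nlinarith
      · rw [Set.indicator_of_notMem h2, mul_zero]; exact zero_le
    · rw [Set.indicator_of_notMem h1, zero_mul]; exact zero_le
  refine (lintegral_mono hpt).trans ?_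
  rw [lintegral_const_mul' _ _ ENNReal.ofReal_ne_top, std_mgf,
    ← ENNReal.ofReal_mul (Real.exp_pos _).le, ← Real.exp_add, hvv]
  refine ENNReal.ofReal_le_ofReal (Real.exp_le_exp.2 ?_)
  have e1 : τ / (1 + τ) = 1 - θ := by rw [hθ]; field_simp; ring
  rw [e1]
  have e2 : (θ * c) ^ 2 * (2 + 2 * inp x x') / 2 ≤ θ * c ^ 2 := by
    have : (θ * c) ^ 2 * (2 + 2 * inp x x') / 2 ≤ (θ * c) ^ 2 * (1 + τ) := by
      have := sq_nonneg (θ * c)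
      nlinarith
    refine this.trans (le_of_eq ?_)
    calc (θ * c) ^ 2 * (1 + τ) = (θ * (1 + τ)) * (θ * c ^ 2) := by ring
      _ = _ := by rw [hθτ, one_mul]
  have e3 : 0 ≤ θ * (c * s) := mul_nonneg hθ0 (mul_nonneg hc hs)
  nlinarith

lemma kl_bound {α : Type*} [MeasurableSpace α] (μ ν : Measure α) [IsProbabilityMeasure μ]
    {B : ℝ} (hB : 0 ≤ B) (hfin : ∀ᵐ x ∂μ, μ.rnDeriv ν x ≠ ∞)
    (h : ∫⁻ x, μ.rnDeriv ν x ∂μ ≤ ENNReal.ofReal (Real.exp B)) : klReal μ ν ≤ B + 1 := by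
  unfold klReal
  by_cases hi : Integrable (fun x => Real.log (μ.rnDeriv ν x).toReal) μ
  · have hm := Measure.measurable_rnDeriv μ ν
    have hi2 : Integrable (fun x => (μ.rnDeriv ν x).toReal) μ :=
      integrable_toReal_of_lintegral_ne_top hm.aemeasurable (ne_top_of_le_ne_top ENNReal.ofReal_ne_top h)
    have hint : ∫ x, (μ.rnDeriv ν x).toReal ∂μ ≤ Real.exp B := by
      rw [integral_toReal hm.aemeasurable (hfin.mono fun x hx => lt_top_iff_ne_top.2 hx)]
      exact ENNReal.toReal_le_of_le_ofReal (Real.exp_pos _).le h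
    calc ∫ x, Real.log (μ.rnDeriv ν x).toReal ∂μ
        ≤ ∫ x, (B + Real.exp (-B) * (μ.rnDeriv ν x).toReal) ∂μ := by
          refine integral_mono hi ((integrable_const _).add (hi2.const_mul _)) fun x => ?_
          rcases (ENNReal.toReal_nonneg (a := μ.rnDeriv ν x)).eq_or_lt' with h0 | h0
          · simp only [h0]; simpa using hB
          · have h1 := Real.add_one_le_exp (Real.log (μ.rnDeriv ν x).toReal - B)
            rw [sub_eq_add_neg, Real.exp_add, Real.exp_log h0] at h1
            simp only
            linarith
      _ = B + Real.exp (-B) * ∫ x, (μ.rnDeriv ν x).toReal ∂μ := by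
          rw [integral_add (integrable_const _) (hi2.const_mul _), integral_const_mul]; simp
      _ ≤ B + Real.exp (-B) * Real.exp B := by gcongr
      _ = B + 1 := by rw [← Real.exp_add]; simp
  · rw [integral_undef hi]; linarith

lemma lintegral_unifOn {N : ℕ} (S : Finset (V N)) {f : V N → ℝ≥0∞} (hf : Measurable f) :
    ∫⁻ x, f x ∂(unifOn S) = (S.card : ℝ≥0∞)⁻¹ * ∑ x ∈ S, f x := by
  unfold unifOn
  rw [lintegral_smul_measure, lintegral_finsetSum_measure, smul_eq_mul]
  congr 1
  exact Finset.sum_congr rfl fun x _ => lintegral_dirac' x hf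

lemma unifOn_prob {N : ℕ} {S : Finset (V N)} (hS : S.card ≠ 0) :
    IsProbabilityMeasure (unifOn S) := by
  constructor
  have h := lintegral_unifOn S (f := fun _ => 1) measurable_const
  simp only [lintegral_const, one_mul, Finset.sum_const, nsmul_eq_mul, mul_one] at h
  rw [h, ENNReal.inv_mul_cancel (by exact_mod_cast hS) (ENNReal.natCast_ne_top _)]

instance unifOn_sfinite {N : ℕ} (S : Finset (V N)) : SFinite (unifOn S) := by
  unfold unifOn; infer_instance

lemma measurable_jmap {N : ℕ} (lam : ℝ) : Measurable
    (fun q : V N × V N => ((q.1, fun i => Real.sqrt lam * q.1 i + q.2 i) : V N × V N)) := by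
  fun_prop

lemma jointLaw_apply {N : ℕ} (S : Finset (V N)) (lam : ℝ) {A : Set (V N × V N)}
    (hA : MeasurableSet A) :
    jointLaw N S lam A = (S.card : ℝ≥0∞)⁻¹ *
      ∑ x ∈ S, stdGaussian N {z | (x, fun i => Real.sqrt lam * x i + z i) ∈ A} := by
  unfold jointLaw
  have hA' := measurable_jmap (N := N) lam hA
  rw [Measure.map_apply (measurable_jmap lam) hA, Measure.prod_apply hA',
    lintegral_unifOn S (measurable_measure_prodMk_left hA')]
  rfl

lemma jointLaw_prob {N : ℕ} {S : Finset (V N)} (hS : S.card ≠ 0) (lam : ℝ) :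
    IsProbabilityMeasure (jointLaw N S lam) := by
  have := unifOn_prob hS
  unfold jointLaw
  exact Measure.isProbabilityMeasure_map (measurable_jmap lam).aemeasurable

lemma Q_zero {N : ℕ} {S : Finset (V N)} (hS : S.card ≠ 0) : Q N S 0 = stdGaussian N := by
  have := unifOn_prob hS
  unfold Q jointLaw
  rw [Measure.map_map measurable_snd (measurable_jmap 0)]
  have : (Prod.snd ∘ fun q : V N × V N =>
      ((q.1, fun i => Real.sqrt 0 * q.1 i + q.2 i) : V N × V N)) = Prod.snd := by
    ext q i; simp
  rw [this]
  change ((unifOn S).prod (stdGaussian N)).snd = _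
  exact Measure.snd_prod

/-- The window event. -/
def Om {N : ℕ} (c s : ℝ) : Set (V N × V N) := {q | |inp q.1 q.2 - c| ≤ s}

lemma measurableSet_Om {N : ℕ} (c s : ℝ) : MeasurableSet (Om c s : Set (V N × V N)) := by
  have := measurable_inp (N := N)
  exact measurableSet_le (by fun_prop) measurable_const

lemma shift_apply {N : ℕ} {lam s : ℝ} {x : V N} (hx : inp x x = 1)
    {A : Set (V N)} (hA : MeasurableSet A) :
    stdGaussian N {z | (x, fun i => Real.sqrt lam * x i + z i) ∈
        (Om (Real.sqrt lam) s ∩ Prod.snd ⁻¹' A : Set (V N × V N))}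
      = ∫⁻ y in A, G (Real.sqrt lam) s x y ∂(stdGaussian N) := by
  have hm : Measurable (fun (z : V N) (i : Fin N) => Real.sqrt lam * x i + z i) := by fun_prop
  have hw := measurableSet_win (Real.sqrt lam) s x
  have h1 : {z | (x, fun i => Real.sqrt lam * x i + z i) ∈
        (Om (Real.sqrt lam) s ∩ Prod.snd ⁻¹' A : Set (V N × V N))}
      = (fun (z : V N) (i : Fin N) => Real.sqrt lam * x i + z i) ⁻¹'
        ({y | |inp x y - Real.sqrt lam| ≤ s} ∩ A) := rfl
  rw [h1, ← Measure.map_apply hm (hw.inter hA),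
    std_shift (fun i => Real.sqrt lam * x i), withDensity_apply _ (hw.inter hA),
    ← Measure.restrict_restrict hw, ← lintegral_indicator hw]
  simp only [inp_smul_left, inp_smul_right, hx, mul_one, ← pow_two]
  rfl

/-- The density of the conditional law. -/
def Ldens {N : ℕ} (S : Finset (V N)) (lam s : ℝ) (y : V N) : ℝ≥0∞ :=
  ((jointLaw N S lam (Om (Real.sqrt lam) s))⁻¹ * (S.card : ℝ≥0∞)⁻¹) *
    ∑ x ∈ S, G (Real.sqrt lam) s x y

lemma measurable_Ldens {N : ℕ} (S : Finset (V N)) (lam s : ℝ) : Measurable (Ldens S lam s) := by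
  unfold Ldens
  exact (Finset.measurable_fun_sum _ fun x _ => measurable_G _ _ x).const_mul _

lemma condQ_eq {N : ℕ} {S : Finset (V N)} (hS : onSphere S) (lam s : ℝ) :
    condQ N S lam (Om (Real.sqrt lam) s) = (stdGaussian N).withDensity (Ldens S lam s) := by
  ext A hA
  unfold condQ
  rw [Measure.map_apply measurable_snd hA, cond_apply (measurableSet_Om _ _),
    jointLaw_apply S lam ((measurableSet_Om _ _).inter (measurable_snd hA)),
    withDensity_apply _ hA]
  unfold Ldens
  rw [lintegral_const_mul _ (Finset.measurable_fun_sum _ fun x _ => measurable_G _ _ x),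
    lintegral_finsetSum _ (fun x _ => measurable_G _ _ x), mul_assoc]
  congr 2
  exact Finset.sum_congr rfl fun x hx => shift_apply (inp_self hS hx) hA

lemma window_compl {N : ℕ} {lam s : ℝ} {x : V N} (hx : inp x x = 1) :
    stdGaussian N {z | (x, fun i => Real.sqrt lam * x i + z i) ∉
        (Om (Real.sqrt lam) s : Set (V N × V N))} ≤
      ENNReal.ofReal (2 * Real.exp (1 / 2 - s)) := by
  refine le_trans (measure_mono fun z hz => ?_) (std_tail hx s)
  have hz' : ¬ |inp x (fun i => Real.sqrt lam * x i + z i) - Real.sqrt lam| ≤ s := hz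
  rw [inp_add_right (fun i => Real.sqrt lam * x i), inp_smul_right, hx] at hz'
  simpa using hz'

lemma joint_Om_ge {N : ℕ} {S : Finset (V N)} (hS : onSphere S) (hc : S.card ≠ 0) {lam s : ℝ}
    (hs : 2 * Real.exp (1 / 2 - s) ≤ 1 / 2) :
    (2 : ℝ≥0∞)⁻¹ ≤ jointLaw N S lam (Om (Real.sqrt lam) s) := by
  have := jointLaw_prob hc lam
  have h1 : jointLaw N S lam (Om (Real.sqrt lam) s)ᶜ ≤ (2 : ℝ≥0∞)⁻¹ := by
    rw [jointLaw_apply S lam (measurableSet_Om _ _).compl]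
    calc _ ≤ (S.card : ℝ≥0∞)⁻¹ * ∑ x ∈ S, (2 : ℝ≥0∞)⁻¹ := by
          gcongr with x hx
          refine (window_compl (inp_self hS hx)).trans ?_
          refine (ENNReal.ofReal_le_ofReal hs).trans ?_
          rw [one_div, ENNReal.ofReal_inv_of_pos two_pos]; simp
      _ = _ := by
          rw [Finset.sum_const, nsmul_eq_mul, ← mul_assoc,
            ENNReal.inv_mul_cancel (by exact_mod_cast hc) (ENNReal.natCast_ne_top _), one_mul]
  have h2 := prob_add_prob_compl (μ := jointLaw N S lam) (measurableSet_Om (Real.sqrt lam) s)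
  by_contra hlt
  rw [not_le] at hlt
  have h3 := ENNReal.add_lt_add_of_lt_of_le (by simp [measure_ne_top]) hlt h1
  rw [h2, ENNReal.inv_two_add_inv_two] at h3
  exact lt_irrefl _ h3

lemma grid_pt {t lam e : ℝ} (hlam : 0 ≤ lam) (ht : t ≤ 1) {K : ℕ} (hK : 0 < K) :
    ENNReal.ofReal (Real.exp (lam * (max t 0 / (1 + max t 0)) + e)) ≤
      ENNReal.ofReal (Real.exp (e + lam / K)) * (1 + ∑ k ∈ Finset.range (K + 1),
        ENNReal.ofReal (Real.exp (lam * (((k : ℝ) / K) / (1 + (k : ℝ) / K)))) *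
          (if ((k : ℝ) / K) ≤ t then 1 else 0)) := by
  have hK' : (0 : ℝ) < K := by exact_mod_cast hK
  rcases lt_or_ge t 0 with h | h
  · rw [max_eq_right h.le]
    refine le_trans ?_ (mul_le_mul_right (le_add_of_nonneg_right zero_le) _)
    rw [mul_one]
    refine ENNReal.ofReal_le_ofReal (Real.exp_le_exp.2 ?_)
    have : 0 ≤ lam / K := by positivity
    simp; linarith
  · rw [max_eq_left h]
    set k := ⌊t * K⌋₊ with hk
    have hkK : k ∈ Finset.range (K + 1) := by
      rw [Finset.mem_range, Nat.lt_succ_iff]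
      refine Nat.floor_le_of_le ?_
      nlinarith
    have hk1 : (k : ℝ) / K ≤ t := by
      rw [div_le_iff₀ hK']; exact Nat.floor_le (by positivity)
    have hk2 : t ≤ (k : ℝ) / K + 1 / K := by
      rw [← add_div, le_div_iff₀ hK']; exact (Nat.lt_floor_add_one _).le
    have hk0 : 0 ≤ (k : ℝ) / K := by positivity
    have hsum := Finset.single_le_sum (f := fun k : ℕ =>
      ENNReal.ofReal (Real.exp (lam * (((k : ℝ) / K) / (1 + (k : ℝ) / K)))) *
          (if ((k : ℝ) / K) ≤ t then 1 else 0)) (fun _ _ => zero_le) hkK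
    simp only [if_pos hk1, mul_one] at hsum
    refine le_trans ?_ (mul_le_mul_right (hsum.trans (le_add_of_nonneg_left zero_le)) _)
    rw [← ENNReal.ofReal_mul (Real.exp_pos _).le, ← Real.exp_add]
    refine ENNReal.ofReal_le_ofReal (Real.exp_le_exp.2 ?_)
    generalize hu : (k : ℝ) / K = u at *
    have h3 : t / (1 + t) - u / (1 + u) ≤ t - u := by
      have : t / (1 + t) - u / (1 + u) = (t - u) / ((1 + t) * (1 + u)) := by
        field_simp; ring
      rw [this]
      apply div_le_self (by linarith)
      nlinarith
    have h4 : t / (1 + t) ≤ u / (1 + u) + 1 / K := by linarith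
    have h5 := mul_le_mul_of_nonneg_left h4 hlam
    rw [mul_add, mul_one_div] at h5
    linarith

lemma second_moment {N : ℕ} {S : Finset (V N)} (hS : onSphere S) (hc : S.card ≠ 0) {lam s : ℝ}
    (hlam : 0 ≤ lam) (hs0 : 0 ≤ s) (hs : 2 * Real.exp (1 / 2 - s) ≤ 1 / 2)
    {K : ℕ} (hK : 0 < K) {D : ℝ} (hD : 0 ≤ D)
    (hrate : ∀ k ∈ Finset.range (K + 1),
      ((unifOn S).prod (unifOn S)) {q | (k : ℝ) / K ≤ inp q.1 q.2} ≤
        ENNReal.ofReal (Real.exp (lam * (D - ((k : ℝ) / K) / (1 + (k : ℝ) / K))))) :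
    ∫⁻ y, Ldens S lam s y * Ldens S lam s y ∂(stdGaussian N) ≤
      ENNReal.ofReal (4 * (K + 2) *
        Real.exp (2 * Real.sqrt lam * s + lam / K + lam * D)) := by
  have := unifOn_prob hc
  set c := Real.sqrt lam with hcdef
  have hc2 : c ^ 2 = lam := Real.sq_sqrt hlam
  have hc0 : 0 ≤ c := Real.sqrt_nonneg _
  set p := jointLaw N S lam (Om c s) with hp
  have hp2 : p⁻¹ ≤ 2 := by
    rw [ENNReal.inv_le_iff_inv_le]; exact joint_Om_ge hS hc hs
  set m : ℝ≥0∞ := (S.card : ℝ≥0∞)⁻¹ with hm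
  set F : V N × V N → ℝ≥0∞ := fun q => ENNReal.ofReal (Real.exp (2 * c * s + lam / K)) *
      (1 + ∑ k ∈ Finset.range (K + 1),
        ENNReal.ofReal (Real.exp (lam * (((k : ℝ) / K) / (1 + (k : ℝ) / K)))) *
          (if ((k : ℝ) / K) ≤ inp q.1 q.2 then 1 else 0)) with hF
  have hmi := measurable_inp (N := N)
  have hset : ∀ k : ℕ, MeasurableSet {q : V N × V N | (k : ℝ) / K ≤ inp q.1 q.2} := fun k =>
    measurableSet_le measurable_const hmi
  have hite : ∀ k : ℕ, Measurable (fun q : V N × V N =>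
      (if ((k : ℝ) / K) ≤ inp q.1 q.2 then (1 : ℝ≥0∞) else 0)) := fun k =>
    Measurable.ite (hset k) measurable_const measurable_const
  have hFm : Measurable F := by
    refine Measurable.const_mul (Measurable.const_add ?_ _) _
    exact Finset.measurable_fun_sum _ fun k _ => (hite k).const_mul _
  have h1 : ∫⁻ y, Ldens S lam s y * Ldens S lam s y ∂(stdGaussian N)
      = (p⁻¹ * p⁻¹) * (m * ∑ x ∈ S, m * ∑ x' ∈ S,
          ∫⁻ y, G c s x y * G c s x' y ∂(stdGaussian N)) := by
    have : ∀ y, Ldens S lam s y * Ldens S lam s y = (p⁻¹ * p⁻¹ * (m * m)) *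
        ∑ x ∈ S, ∑ x' ∈ S, G c s x y * G c s x' y := by
      intro y
      rw [← Finset.sum_mul_sum]
      unfold Ldens
      ring
    simp_rw [this]
    have hG2 : ∀ x x' : V N, Measurable fun y => G c s x y * G c s x' y := fun x x' =>
      (measurable_G c s x).mul (measurable_G c s x')
    rw [lintegral_const_mul _ (Finset.measurable_fun_sum _ fun x _ =>
      Finset.measurable_fun_sum _ fun x' _ => hG2 x x'),
      lintegral_finsetSum _ (fun x _ => Finset.measurable_fun_sum _ fun x' _ => hG2 x x')]
    rw [Finset.sum_congr rfl fun x _ => lintegral_finsetSum _ (fun x' _ => hG2 x x'),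
      ← Finset.mul_sum]
    ring
  have h2 : m * ∑ x ∈ S, m * ∑ x' ∈ S, ∫⁻ y, G c s x y * G c s x' y ∂(stdGaussian N)
      ≤ ∫⁻ q, F q ∂((unifOn S).prod (unifOn S)) := by
    rw [lintegral_prod _ hFm.aemeasurable, lintegral_unifOn S hFm.lintegral_prod_right']
    refine mul_le_mul_right (Finset.sum_le_sum fun x hx => ?_) _
    rw [lintegral_unifOn S (f := fun y => F (x, y)) (hFm.comp measurable_prodMk_left)]
    refine mul_le_mul_right (Finset.sum_le_sum fun x' hx' => ?_) _
    have hx1 := inp_self hS hx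
    have hx1' := inp_self hS hx'
    refine (pair_bound hc0 hs0 hx1 hx1').trans ?_
    rw [hc2]
    exact grid_pt hlam (inp_le_one hx1 hx1') hK
  have h3 : ∫⁻ q, F q ∂((unifOn S).prod (unifOn S)) ≤
      ENNReal.ofReal (Real.exp (2 * c * s + lam / K)) *
        ENNReal.ofReal ((K + 2) * Real.exp (lam * D)) := by
    rw [hF, lintegral_const_mul _ (Measurable.const_add
        (Finset.measurable_fun_sum _ fun k _ => (hite k).const_mul _) _),
      lintegral_add_left measurable_const,
      lintegral_finsetSum _ (fun k _ => (hite k).const_mul _)]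
    refine mul_le_mul_right ?_ _
    have hk : ∀ k ∈ Finset.range (K + 1), ∫⁻ q : V N × V N,
        ENNReal.ofReal (Real.exp (lam * (((k : ℝ) / K) / (1 + (k : ℝ) / K)))) *
          (if ((k : ℝ) / K) ≤ inp q.1 q.2 then 1 else 0) ∂((unifOn S).prod (unifOn S))
        ≤ ENNReal.ofReal (Real.exp (lam * D)) := by
      intro k hk
      rw [lintegral_const_mul _ (hite k)]
      have : ∫⁻ q : V N × V N, (if ((k : ℝ) / K) ≤ inp q.1 q.2 then 1 else 0)
          ∂((unifOn S).prod (unifOn S))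
          = ((unifOn S).prod (unifOn S)) {q | (k : ℝ) / K ≤ inp q.1 q.2} := by
        rw [← lintegral_indicator_one (hset k)]
        refine lintegral_congr fun q => ?_
        simp [Set.indicator_apply]
      rw [this]
      refine (mul_le_mul_right (hrate k hk) _).trans (le_of_eq ?_)
      rw [← ENNReal.ofReal_mul (Real.exp_pos _).le, ← Real.exp_add]
      congr 2; ring
    have h1e : (1 : ℝ≥0∞) ≤ ENNReal.ofReal (Real.exp (lam * D)) := by
      rw [ENNReal.one_le_ofReal]
      exact Real.one_le_exp (by positivity)
    calc _ ≤ ENNReal.ofReal (Real.exp (lam * D)) +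
          ∑ k ∈ Finset.range (K + 1), ENNReal.ofReal (Real.exp (lam * D)) := by
          refine add_le_add ?_ (Finset.sum_le_sum hk)
          simpa using h1e
      _ = _ := by
          rw [Finset.sum_const, Finset.card_range, nsmul_eq_mul,
            ENNReal.ofReal_mul (by positivity)]
          have : ENNReal.ofReal ((K : ℝ) + 2) = (K : ℝ≥0∞) + 2 := by
            rw [ENNReal.ofReal_add (by positivity) (by positivity)]; simp
          rw [this]; push_cast; ring
  rw [h1]
  calc _ ≤ (2 * 2) * (ENNReal.ofReal (Real.exp (2 * c * s + lam / K)) *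
        ENNReal.ofReal ((K + 2) * Real.exp (lam * D))) := by
        exact mul_le_mul' (mul_le_mul' hp2 hp2) (h2.trans h3)
    _ = _ := by
        have h4 : (2 * 2 : ℝ≥0∞) = ENNReal.ofReal 4 := by norm_num
        rw [h4, ← ENNReal.ofReal_mul (Real.exp_pos _).le, ← ENNReal.ofReal_mul (by norm_num)]
        congr 1
        rw [Real.exp_add (2 * c * s + lam / K)]; ring

lemma kl_fixed {N : ℕ} {S : Finset (V N)} (hS : onSphere S) (hc : S.card ≠ 0) {lam s : ℝ}
    (hlam : 0 ≤ lam) (hs0 : 0 ≤ s) (hs : 2 * Real.exp (1 / 2 - s) ≤ 1 / 2)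
    {K : ℕ} (hK : 0 < K) {D : ℝ} (hD : 0 ≤ D)
    (hrate : ∀ k ∈ Finset.range (K + 1),
      ((unifOn S).prod (unifOn S)) {q | (k : ℝ) / K ≤ inp q.1 q.2} ≤
        ENNReal.ofReal (Real.exp (lam * (D - ((k : ℝ) / K) / (1 + (k : ℝ) / K))))) :
    klReal (condQ N S lam (Om (Real.sqrt lam) s)) (Q N S 0) ≤
      Real.log (4 * (K + 2)) + (2 * Real.sqrt lam * s + lam / K + lam * D) + 1 := by
  have h2m := second_moment hS hc hlam hs0 hs hK hD hrate
  have hpc : IsProbabilityMeasure (condQ N S lam (Om (Real.sqrt lam) s)) := by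
    have := jointLaw_prob hc lam
    have hne : jointLaw N S lam (Om (Real.sqrt lam) s) ≠ 0 := by
      intro h0
      have := joint_Om_ge (lam := lam) hS hc hs
      rw [h0] at this
      simp at this
    have := cond_isProbabilityMeasure hne
    unfold condQ
    exact Measure.isProbabilityMeasure_map measurable_snd.aemeasurable
  rw [Q_zero hc]
  have hL := measurable_Ldens S lam s
  have hac : condQ N S lam (Om (Real.sqrt lam) s) ≪ stdGaussian N := by
    rw [condQ_eq hS]; exact withDensity_absolutelyContinuous _ _
  have hrn : (condQ N S lam (Om (Real.sqrt lam) s)).rnDeriv (stdGaussian N)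
      =ᵐ[stdGaussian N] Ldens S lam s := by
    rw [condQ_eq hS]; exact Measure.rnDeriv_withDensity _ hL
  have hK1 : (1 : ℝ) ≤ 4 * (K + 2) := by
    have : (0 : ℝ) ≤ K := by positivity
    linarith
  refine kl_bound _ _ ?_ (hac (Measure.rnDeriv_ne_top _ _)) ?_
  · have := Real.log_nonneg hK1
    positivity
  · rw [lintegral_congr_ae (hac hrn), condQ_eq hS, lintegral_withDensity_eq_lintegral_mul _ hL hL,
      Real.exp_add, Real.exp_log (by linarith)]
    exact h2m


/-- Theorem 5 of the paper. Suppose the priors have overlap rate function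
`r` (nondecreasing, nonnegative on `[-1,1]`). With `λ_N = 2 log M_N`, the events
`Ω_N = {(x,y) : |⟨x,y⟩ - √λ_N| ≤ λ_N^{1/4}}` occur with uniformly high probability, and the
conditional law `Q̃_{λ_N,N}` of `Y` given `(X,Y) ∈ Ω_N` satisfies
`limsup_N (1/λ_N) D(Q̃_{λ_N,N} ‖ Q_{0,N}) ≤ sup_{t ∈ [0,1]} (t/(1+t) - r(t)/2)₊`. -/
theorem statement9 (S : ∀ N : ℕ, Finset (V N)) (hsphere : ∀ N, onSphere (S N))
    (hM : Tendsto (fun N => (S N).card) atTop atTop)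
    (r : ℝ → ℝ) (hr0 : ∀ t : ℝ, 0 ≤ r t)
    (hrmono : ∀ t t' : ℝ, -1 ≤ t → t ≤ t' → t' ≤ 1 → r t ≤ r t')
    (hrate : ∀ t : ℝ, -1 ≤ t → t ≤ 1 → overlapRateLe S t (-(r t))) :
    uniformlyHigh S (fun N => 2 * Real.log (S N).card)
      (fun N => {q : V N × V N |
        |inp q.1 q.2 - Real.sqrt (2 * Real.log (S N).card)|
          ≤ (2 * Real.log (S N).card) ^ ((1 : ℝ) / 4)}) ∧
    ∀ ε : ℝ, 0 < ε → ∀ᶠ N in atTop,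
      klReal
          (condQ N (S N) (2 * Real.log (S N).card)
            {q : V N × V N |
              |inp q.1 q.2 - Real.sqrt (2 * Real.log (S N).card)|
                ≤ (2 * Real.log (S N).card) ^ ((1 : ℝ) / 4)})
          (Q N (S N) 0)
        / (2 * Real.log (S N).card)
        ≤ (⨆ t ∈ Set.Icc (0 : ℝ) 1, max (t / (1 + t) - r t / 2) 0) + ε := by

  have hcard : Tendsto (fun N => ((S N).card : ℝ)) atTop atTop :=
    tendsto_natCast_atTop_atTop.comp hM
  have hlamT : Tendsto (fun N => 2 * Real.log (S N).card) atTop atTop :=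
    (Real.tendsto_log_atTop.comp hcard).const_mul_atTop two_pos
  have hsT : Tendsto (fun N => (2 * Real.log (S N).card) ^ ((1 : ℝ) / 4)) atTop atTop :=
    (tendsto_rpow_atTop (by norm_num)).comp hlamT
  have htail : ∀ ε : ℝ, 0 < ε → ∀ᶠ N in atTop,
      2 * Real.exp (1 / 2 - (2 * Real.log (S N).card) ^ ((1 : ℝ) / 4)) ≤ ε := by
    intro ε hε
    filter_upwards [hsT.eventually_ge_atTop (1 / 2 - Real.log (ε / 2))] with N hN
    have : Real.exp (1 / 2 - (2 * Real.log (S N).card) ^ ((1 : ℝ) / 4)) ≤ ε / 2 := by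
      rw [← Real.le_log_iff_exp_le (by positivity)]; linarith
    linarith
  refine ⟨?_, ?_⟩
  · intro ε hε
    filter_upwards [htail ε hε] with N hN x hx
    exact (window_compl (inp_self (hsphere N) hx)).trans (ENNReal.ofReal_le_ofReal hN)
  · intro ε hε
    set s0 : ℝ := ⨆ t ∈ Set.Icc (0 : ℝ) 1, max (t / (1 + t) - r t / 2) 0 with hs0
    have hin : ∀ t : ℝ, 0 ≤ (⨆ _ : t ∈ Set.Icc (0 : ℝ) 1, max (t / (1 + t) - r t / 2) 0) :=
      fun t => Real.iSup_nonneg fun _ => le_max_right _ _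
    have hbdd : BddAbove (Set.range fun t : ℝ =>
        ⨆ _ : t ∈ Set.Icc (0 : ℝ) 1, max (t / (1 + t) - r t / 2) 0) := by
      refine ⟨1, ?_⟩
      rintro _ ⟨t, rfl⟩
      refine Real.iSup_le (fun ht => max_le ?_ zero_le_one) zero_le_one
      have h1 : t / (1 + t) ≤ 1 := by
        rw [div_le_one (by linarith [ht.1])]; linarith
      have := hr0 t
      linarith
    have hs0_nonneg : 0 ≤ s0 := Real.iSup_nonneg hin
    have hs0_le : ∀ t ∈ Set.Icc (0 : ℝ) 1, t / (1 + t) - r t / 2 ≤ s0 := by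
      intro t ht
      have h1 := le_ciSup hbdd t
      simp only [ciSup_pos ht] at h1
      exact (le_max_left _ _).trans h1
    obtain ⟨K, hK⟩ := exists_nat_gt (4 / ε)
    have hKpos' : (0 : ℝ) < K := lt_trans (by positivity) hK
    have hKpos : 0 < K := by exact_mod_cast hKpos'
    have hKε : 1 / (K : ℝ) ≤ ε / 4 := by
      rw [div_lt_iff₀ hε] at hK
      rw [div_le_iff₀ hKpos']; linarith
    set C : ℝ := Real.log (4 * (K + 2)) + 1 with hC
    have hC0 : 0 ≤ C := by
      have := Real.log_nonneg (show (1 : ℝ) ≤ 4 * (K + 2) by linarith)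
      linarith
    have hgrid : ∀ᶠ N in atTop, ∀ k ∈ Finset.range (K + 1),
        ((unifOn (S N)).prod (unifOn (S N))) {q | (k : ℝ) / K ≤ inp q.1 q.2}
          ≤ ((S N).card : ℝ≥0∞) ^ (-(r ((k : ℝ) / K)) + ε / 2) := by
      rw [Filter.eventually_all_finset]
      intro k hk
      have hk' : (k : ℝ) ≤ K := by
        have := Finset.mem_range.1 hk
        exact_mod_cast Nat.lt_succ_iff.1 this
      have h0 : 0 ≤ (k : ℝ) / K := by positivity
      exact hrate _ (by linarith) ((div_le_one hKpos').2 hk') _ (by positivity)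
    filter_upwards [hgrid, htail (1 / 2) (by norm_num), hM.eventually_ge_atTop 1,
      hlamT.eventually_ge_atTop 1, hsT.eventually_ge_atTop 1,
      hsT.eventually_ge_atTop ((C + 2) * 2 / ε)] with N hg ht hcN hl1 hs1 hs2
    have hcpos : (0 : ℝ) < (S N).card := by exact_mod_cast hcN
    generalize hlam : 2 * Real.log (S N).card = lam at *
    generalize hs : lam ^ ((1 : ℝ) / 4) = s at *
    have hlam0 : 0 ≤ lam := by linarith
    have hlams : lam = s ^ 4 := by
      rw [← hs, ← Real.rpow_natCast, ← Real.rpow_mul hlam0]; norm_num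
    have hsqrt : Real.sqrt lam = s ^ 2 := by
      rw [hlams, show s ^ 4 = (s ^ 2) ^ 2 by ring, Real.sqrt_sq (by positivity)]
    have hkl := kl_fixed (hsphere N) (by omega) hlam0 (by linarith) ht hKpos
      (D := s0 + ε / 4) (by positivity) (by
        intro k hk
        refine (hg k hk).trans ?_
        rw [← ENNReal.ofReal_natCast, ENNReal.ofReal_rpow_of_pos hcpos,
          Real.rpow_def_of_pos hcpos]
        refine ENNReal.ofReal_le_ofReal (Real.exp_le_exp.2 ?_)
        have hk' : (k : ℝ) ≤ K := by
          have := Finset.mem_range.1 hk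
          exact_mod_cast Nat.lt_succ_iff.1 this
        have h1 := hs0_le ((k : ℝ) / K) ⟨by positivity, (div_le_one hKpos').2 hk'⟩
        have h2 : Real.log (S N).card = lam / 2 := by linarith
        rw [h2]
        have h3 := mul_le_mul_of_nonneg_left h1 hlam0
        linarith)
    change klReal (condQ N (S N) lam (Om (Real.sqrt lam) s)) (Q N (S N) 0) / lam ≤ _
    rw [div_le_iff₀ (by linarith)]
    refine hkl.trans ?_
    have h1 : lam / K ≤ lam * (ε / 4) := by
      rw [← mul_one_div]; exact mul_le_mul_of_nonneg_left hKε hlam0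
    have h2 : C + 2 * Real.sqrt lam * s ≤ lam * (ε / 2) := by
      rw [hsqrt, hlams]
      rw [div_le_iff₀ hε] at hs2
      have h3 : 1 ≤ s ^ 3 := one_le_pow₀ hs1
      have h4 : C ≤ C * s ^ 3 := le_mul_of_one_le_right hC0 h3
      have h5 := mul_le_mul_of_nonneg_right hs2 (show 0 ≤ s ^ 3 by positivity)
      nlinarith
    linarith
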